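/- Let G be a P5-free graph, let Q be a set of vertices of G, and let x be a vertex with x ∉ Q. Then there is at most one connected component Y of the subgraph induced by Q such that x is adjacent to some vertex of Y but not adjacent to every vertex of Y. Equivalently: if Y1 and Y2 are distinct connected components of the subgraph induced by Q, each containing a vertex adjacent to x, then x is adjacent to every vertex of Y1 or x is adjacent to every vertex of Y2. -/

import Mathlib

/-- A graph is `P₅`-free if it contains no induced subgraph isomorphic to the
path on five vertices. -/
def P5Free {V : Type*} (G : SimpleGraph V) : Prop :=
  ∀ f : Fin 5 ↪ V, ¬ (∀ i j, G.Adj (f i) (f j) ↔ (SimpleGraph.pathGraph 5).Adj i j)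

/-- `Y` is (the vertex set of) a connected component of the subgraph of `G`
induced by `S`. -/
def IsCompOf {V : Type*} (G : SimpleGraph V) (S Y : Set V) : Prop :=
  ∃ u : S, Y = {w : V | ∃ h : w ∈ S, (G.induce S).Reachable ⟨w, h⟩ u}

/-- Two components of an induced subgraph that share a vertex, or are joined by an edge,
coincide. -/
theorem IsCompOf.eq_of_eq_or_adj {V : Type*} {G : SimpleGraph V} {S Y Z : Set V}
    (hY : IsCompOf G S Y) (hZ : IsCompOf G S Z) {a b : V} (ha : a ∈ Y) (hb : b ∈ Z)
    (hab : a = b ∨ G.Adj a b) : Y = Z := by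
  obtain ⟨u, rfl⟩ := hY
  obtain ⟨v, rfl⟩ := hZ
  obtain ⟨haS, hau⟩ := ha
  obtain ⟨hbS, hbv⟩ := hb
  have h : (G.induce S).Reachable ⟨a, haS⟩ ⟨b, hbS⟩ := by
    rcases hab with rfl | h
    · exact .refl _
    · exact SimpleGraph.Adj.reachable (SimpleGraph.induce_adj.mpr h)
  have huv : (G.induce S).Reachable u v := hau.symm.trans (h.trans hbv)
  ext w
  exact ⟨fun ⟨hw, hwu⟩ => ⟨hw, hwu.trans huv⟩, fun ⟨hw, hwv⟩ => ⟨hw, hwv.trans huv.symm⟩⟩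

/-- A component of an induced subgraph meeting a set `N` but not contained in it has an edge
leaving `N`. -/
theorem IsCompOf.exists_adj_mem_notMem {V : Type*} {G : SimpleGraph V} {S Y N : Set V}
    (hY : IsCompOf G S Y) {a b : V} (ha : a ∈ Y) (hb : b ∈ Y) (haN : a ∈ N) (hbN : b ∉ N) :
    ∃ c ∈ Y, ∃ d ∈ Y, c ∈ N ∧ d ∉ N ∧ G.Adj c d := by
  obtain ⟨u, rfl⟩ := hY
  obtain ⟨haS, hau⟩ := ha
  obtain ⟨hbS, hbu⟩ := hb
  classical
  obtain ⟨p⟩ := hau.trans hbu.symm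
  obtain ⟨e, he, h1, h2⟩ := p.exists_boundary_dart (Subtype.val ⁻¹' N) haN hbN
  have hc : (G.induce S).Reachable e.fst u :=
    (p.takeUntil _ (p.dart_fst_mem_support_of_mem_darts he)).reachable.symm.trans hau
  exact ⟨e.fst, ⟨e.fst.2, hc⟩, e.snd, ⟨e.snd.2, e.adj.reachable.symm.trans hc⟩, h1, h2,
    SimpleGraph.induce_adj.mp e.adj⟩

theorem IsCompOf.subset {V : Type*} {G : SimpleGraph V} {S Y : Set V} (hY : IsCompOf G S Y) :
    Y ⊆ S := by
  obtain ⟨u, rfl⟩ := hY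
  exact fun _ ⟨h, _⟩ => h

/-- In a `P₅`-free graph, a vertex `x ∉ Q` dominates all but at most one of the
components of the subgraph induced by `Q` that it is adjacent to: if `Y₁ ≠ Y₂`
are distinct components each containing a neighbour of `x`, then `x` is
adjacent to every vertex of `Y₁` or to every vertex of `Y₂`. -/
theorem dominates_all_but_one_component
    {V : Type*} (G : SimpleGraph V) (hP5 : P5Free G)
    (Q : Set V) (x : V) (hx : x ∉ Q)
    (Y1 Y2 : Set V) (hY1 : IsCompOf G Q Y1) (hY2 : IsCompOf G Q Y2)
    (hne : Y1 ≠ Y2)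
    (h1 : ∃ y ∈ Y1, G.Adj x y) (h2 : ∃ y ∈ Y2, G.Adj x y) :
    (∀ y ∈ Y1, G.Adj x y) ∨ (∀ y ∈ Y2, G.Adj x y) := by
  by_contra! ⟨⟨z1, hz1, hxz1⟩, z2, hz2, hxz2⟩
  obtain ⟨y1, hy1, hxy1⟩ := h1
  obtain ⟨y2, hy2, hxy2⟩ := h2
  obtain ⟨a1, ha1, b1, hb1, hxa1, hxb1, hab1⟩ :=
    hY1.exists_adj_mem_notMem (N := G.neighborSet x) hy1 hz1 hxy1 hxz1
  obtain ⟨a2, ha2, b2, hb2, hxa2, hxb2, hab2⟩ :=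
    hY2.exists_adj_mem_notMem (N := G.neighborSet x) hy2 hz2 hxy2 hxz2
  rw [SimpleGraph.mem_neighborSet] at hxa1 hxb1 hxa2 hxb2
  have cross : ∀ a ∈ Y1, ∀ b ∈ Y2, a ≠ b ∧ ¬ G.Adj a b := fun a ha b hb =>
    not_or.mp fun h => hne (hY1.eq_of_eq_or_adj hY2 ha hb h)
  obtain ⟨naa, aa⟩ := cross a1 ha1 a2 ha2
  obtain ⟨nab, ab⟩ := cross a1 ha1 b2 hb2
  obtain ⟨nba, ba⟩ := cross b1 hb1 a2 ha2
  obtain ⟨nbb, bb⟩ := cross b1 hb1 b2 hb2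
  have nb1 : b1 ≠ x := fun h => hx (h ▸ hY1.subset hb1)
  have nb2 : b2 ≠ x := fun h => hx (h ▸ hY2.subset hb2)
  have inj : Function.Injective ![b1, a1, x, a2, b2] := by
    intro i j hij
    fin_cases i <;> fin_cases j <;>
      simp_all [hab1.ne, hab1.ne', hab2.ne, hab2.ne', hxa1.ne, hxa1.ne', hxa2.ne, hxa2.ne',
        naa.symm, nab.symm, nba.symm, nbb.symm, nb1.symm, nb2.symm]
  refine hP5 ⟨_, inj⟩ fun i j => ?_
  fin_cases i <;> fin_cases j <;>
    simp [SimpleGraph.pathGraph_adj, hab1, hab1.symm, hab2, hab2.symm, hxa1, hxa1.symm, hxa2,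
      hxa2.symm, hxb1, hxb2, aa, ab, ba, bb, G.adj_comm b1 x, G.adj_comm b2 x, G.adj_comm a2 a1,
      G.adj_comm a2 b1, G.adj_comm b2 a1, G.adj_comm b2 b1]
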